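/- arXiv:1010.4133 — 2 statements merged into one kernel-verified Lean document; each statement's English description precedes it below -/
import Mathlib

section
/- Let n ≥ 2 and let f, h : S¹ → S¹ be orientation-preserving C¹ diffeomorphisms of the circle satisfying h ∘ f ∘ h⁻¹ = fⁿ and generating a faithful action of BS(1,n). Then there exists m ∈ ℕ, m ≥ 1, such that f^{n−1} and h^m have a common fixed point in S¹. -/
noncomputable section

/-- The circle `S¹ = ℝ/ℤ`. -/
abbrev S1 := AddCircle (1 : ℝ)

/-- `F` (a monotone degree-one lift, invertible, hence the lift of an orientation
preserving circle homeomorphism) is a lift of the circle map `g`. -/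
def IsLiftOf (F : CircleDeg1Liftˣ) (g : S1 ≃ₜ S1) : Prop :=
  ∀ x : ℝ, g (x : S1) = (((F : CircleDeg1Lift) x : ℝ) : S1)

/-- The lift is a `C¹` map with everywhere positive derivative, i.e. the corresponding
circle map is an orientation preserving `C¹` diffeomorphism. -/
def IsC1DiffeoLift (F : CircleDeg1Liftˣ) : Prop :=
  ContDiff ℝ 1 ⇑(F : CircleDeg1Lift) ∧ ∀ x : ℝ, 0 < deriv ⇑(F : CircleDeg1Lift) x

/-- The relator of the Baumslag–Solitar group `BS(1,n) = ⟨a,b | a b a⁻¹ = bⁿ⟩`,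
with `a` the generator `0` and `b` the generator `1` of the free group on two letters. -/
def bsRel (n : ℕ) : Set (FreeGroup (Fin 2)) :=
  {FreeGroup.of 0 * FreeGroup.of 1 * (FreeGroup.of 0)⁻¹ * ((FreeGroup.of 1) ^ n)⁻¹}

/-- The action of `BS(1,n)` generated by `h ≡ a` and `f ≡ b` is faithful:
every word in the free group on two letters that acts as the identity lies in the
normal closure of the Baumslag–Solitar relator, i.e. the induced homomorphism
`BS(1,n) → Homeo₊(S¹)` is injective. -/
def IsFaithfulBS (n : ℕ) (f h : S1 ≃ₜ S1) : Prop :=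
  ∀ w : FreeGroup (Fin 2),
    FreeGroup.lift ![h.toEquiv, f.toEquiv] w = 1 → w ∈ Subgroup.normalClosure (bsRel n)

section

open Set Filter Topology MeasureTheory

theorem exists_delta_mul_le_of_periodic {u : ℝ → ℝ} (hc : Continuous u)
    (hp : Function.Periodic u 1) (hpos : ∀ x, 0 < u x) {c : ℝ} (hc0 : 0 < c) (hc1 : c < 1) :
    ∃ δ > 0, ∀ x y, |x - y| < δ → c * u y ≤ u x := by
  have hlp : Function.Periodic (fun x => Real.log (u x)) 1 := fun x => by simp only [hp x]
  have hl : Continuous fun x => Real.log (u x) := hc.log fun x => (hpos x).ne'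
  have hL : Continuous (hlp.lift : AddCircle (1 : ℝ) → ℝ) := hl.quotient_lift _
  have hcoe : UniformContinuous ((↑) : ℝ → AddCircle (1 : ℝ)) :=
    uniformContinuous_addMonoidHom_of_continuous
      (f := QuotientAddGroup.mk' (AddSubgroup.zmultiples (1 : ℝ))) (AddCircle.continuous_mk' 1)
  have hu : UniformContinuous fun x => Real.log (u x) :=
    (CompactSpace.uniformContinuous_of_continuous hL).comp hcoe
  obtain ⟨δ, hδ, h⟩ := Metric.uniformContinuous_iff.1 hu (-Real.log c)
    (neg_pos.2 (Real.log_neg hc0 hc1))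
  refine ⟨δ, hδ, fun x y hxy => ?_⟩
  have := h (a := x) (b := y) hxy
  rw [Real.dist_eq, abs_lt] at this
  rw [← Real.log_le_log_iff (mul_pos hc0 (hpos y)) (hpos x), Real.log_mul hc0.ne' (hpos y).ne']
  linarith

theorem tendsto_sub_zero_of_disjoint_Ioo {a b : ℕ → ℝ} {A B : ℝ} (hab : ∀ k, a k ≤ b k)
    (hA : ∀ k, A ≤ a k) (hB : ∀ k, b k ≤ B)
    (hd : Pairwise (Function.onFun Disjoint fun k => Ioo (a k) (b k))) :
    Tendsto (fun k => b k - a k) atTop (𝓝 0) := by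
  have h1 : ∑' k, volume (Ioo (a k) (b k)) ≤ volume (⋃ k, Ioo (a k) (b k)) :=
    tsum_meas_le_meas_iUnion_of_disjoint _ (fun _ => measurableSet_Ioo) hd
  have h2 : volume (⋃ k, Ioo (a k) (b k)) ≤ volume (Icc A B) :=
    measure_mono (iUnion_subset fun k x hx => ⟨(hA k).trans hx.1.le, hx.2.le.trans (hB k)⟩)
  have h3 : ∑' k, volume (Ioo (a k) (b k)) ≠ ⊤ :=
    ((h1.trans h2).trans_lt (by simp)).ne
  have h4 := ENNReal.tendsto_atTop_zero_of_tsum_ne_top h3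
  have h5 := (ENNReal.tendsto_toReal ENNReal.zero_ne_top).comp h4
  simpa [Function.comp_def, Real.volume_Ioo, fun k => ENNReal.toReal_ofReal (sub_nonneg.2 (hab k))]
    using h5

/-- A point that is not fixed lies in a maximal interval without fixed points. -/
theorem CircleDeg1Lift.exists_component_of_ne {G : CircleDeg1Lift} (hG : Continuous G)
    (hfix : ∃ x, G x = x) {x : ℝ} (hx : G x ≠ x) :
    ∃ a b, a < x ∧ x < b ∧ G a = a ∧ G b = b ∧ ∀ y ∈ Ioo a b, G y ≠ y := by
  obtain ⟨p, hp⟩ := hfix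
  have hcl : IsClosed {y | G y = y} := isClosed_eq hG continuous_id
  have hpk (k : ℤ) : G (p + k) = p + k := by rw [G.map_add_int, hp]
  have hlo : ({y | G y = y} ∩ Iic x).Nonempty := by
    refine ⟨p + ⌊x - p⌋, hpk _, ?_⟩
    have := Int.floor_le (x - p)
    simp only [mem_Iic]; linarith
  have hhi : ({y | G y = y} ∩ Ici x).Nonempty := by
    refine ⟨p + ⌈x - p⌉, hpk _, ?_⟩
    have := Int.le_ceil (x - p)
    simp only [mem_Ici]; linarith
  have ha := (hcl.inter isClosed_Iic).csSup_mem hlo ⟨x, fun y hy => hy.2⟩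
  have hb := (hcl.inter isClosed_Ici).csInf_mem hhi ⟨x, fun y hy => hy.2⟩
  refine ⟨_, _, lt_of_le_of_ne ha.2 ?_, lt_of_le_of_ne hb.2 ?_, ha.1, hb.1, ?_⟩
  · intro h; exact hx (h ▸ ha.1)
  · intro h; exact hx (h ▸ hb.1)
  · rintro y ⟨hay, hyb⟩ hy
    rcases le_total y x with h | h
    · exact hay.not_ge (le_csSup ⟨x, fun y hy => hy.2⟩ ⟨hy, h⟩)
    · exact hyb.not_ge (csInf_le ⟨x, fun y hy => hy.2⟩ ⟨hy, h⟩)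

theorem exists_abs_sub_eq_deriv_mul {φ : ℝ → ℝ} (hd : Differentiable ℝ φ)
    (hpos : ∀ x, 0 < deriv φ x) {a b x y : ℝ} (hx : x ∈ Icc a b) (hy : y ∈ Icc a b) :
    ∃ c ∈ Icc a b, |φ y - φ x| = deriv φ c * |y - x| := by
  wlog hxy : x ≤ y generalizing x y
  · obtain ⟨c, hc, h⟩ := this hy hx (le_of_not_ge hxy)
    exact ⟨c, hc, by rw [abs_sub_comm, h, abs_sub_comm]⟩
  rcases hxy.eq_or_lt with rfl | hxy
  · exact ⟨x, hx, by simp⟩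
  obtain ⟨c, hc, h⟩ := exists_deriv_eq_slope φ hxy hd.continuous.continuousOn hd.differentiableOn
  refine ⟨c, ⟨hx.1.trans hc.1.le, hc.2.le.trans hy.2⟩, ?_⟩
  rw [eq_div_iff (sub_pos.2 hxy).ne'] at h
  rw [← h, abs_mul, abs_of_pos (hpos c)]

theorem mem_Icc_of_fixed {G : ℝ → ℝ} (hm : Monotone G) {a b x : ℝ} (ha : G a = a) (hb : G b = b)
    (hx : x ∈ Icc a b) : G x ∈ Icc a b :=
  ⟨ha.symm.trans_le (hm hx.1), (hm hx.2).trans_eq hb⟩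

theorem abs_iterate_two_sub_le {G : ℝ → ℝ} (hm : Monotone G) {n : ℕ} (hn : 2 ≤ n) (w : ℝ) :
    |G (G w) - G w| + |G w - w| ≤ |G^[n] w - w| := by
  rcases le_total w (G w) with h | h
  · have h2 := hm.monotone_iterate_of_le_map h hn
    have h3 := hm h
    simp only [Function.iterate_succ, Function.iterate_zero, Function.comp_apply, id] at h2
    rw [abs_of_nonneg (by linarith), abs_of_nonneg (by linarith), abs_of_nonneg (by linarith)]
    linarith
  · have h2 := hm.antitone_iterate_of_map_le h hn
    have h3 := hm h
    simp only [Function.iterate_succ, Function.iterate_zero, Function.comp_apply, id] at h2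
    rw [abs_of_nonpos (by linarith), abs_of_nonpos (by linarith), abs_of_nonpos (by linarith)]
    linarith

/-- If `H ∘ G = G^[n] ∘ H` and the distortion of `G` and `H` on the relevant intervals is small,
then pulling an interval back by `H` increases the relative displacement of `G` on it. -/
theorem displacement_div_length_le {G H : ℝ → ℝ} {n : ℕ} (hn : 2 ≤ n) (hGm : Monotone G)
    (hG : Differentiable ℝ G) (hGpos : ∀ x, 0 < deriv G x)
    (hH : Differentiable ℝ H) (hHpos : ∀ x, 0 < deriv H x)
    (hrel : ∀ x, H (G x) = G^[n] (H x)) {a b w : ℝ} (hw : w ∈ Icc a b) (hab : a < b)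
    (ha : G a = a) (hb : G b = b) (hHa : G (H a) = H a) (hHb : G (H b) = H b)
    (hu : ∀ x ∈ Icc (H a) (H b), ∀ y ∈ Icc (H a) (H b), 3 / 4 * deriv G y ≤ deriv G x)
    (hv : ∀ x ∈ Icc a b, ∀ y ∈ Icc a b, 3 / 4 * deriv H y ≤ deriv H x) :
    21 / 16 * (|G (H w) - H w| / (H b - H a)) ≤ |G w - w| / (b - a) := by
  have hHm : StrictMono H := strictMono_of_deriv_pos hHpos
  have hHw : H w ∈ Icc (H a) (H b) := ⟨hHm.monotone hw.1, hHm.monotone hw.2⟩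
  have hGHw := mem_Icc_of_fixed hGm hHa hHb hHw
  obtain ⟨ξ, hξ, h1⟩ := exists_abs_sub_eq_deriv_mul hH hHpos hw (mem_Icc_of_fixed hGm ha hb hw)
  obtain ⟨η, hη, h2⟩ := exists_abs_sub_eq_deriv_mul hH hHpos
    (left_mem_Icc.2 hab.le) (right_mem_Icc.2 hab.le)
  obtain ⟨c, hc, h3⟩ := exists_abs_sub_eq_deriv_mul hG hGpos
    (left_mem_Icc.2 (hHm hab).le) (right_mem_Icc.2 (hHm hab).le)
  obtain ⟨ζ, hζ, h4⟩ := exists_abs_sub_eq_deriv_mul hG hGpos hHw hGHw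
  have hlen : 0 < H b - H a := sub_pos.2 (hHm hab)
  have hlen' : 0 < b - a := sub_pos.2 hab
  rw [abs_of_pos hlen, abs_of_pos hlen'] at h2
  rw [hHa, hHb, abs_of_pos hlen] at h3
  have hc1 : deriv G c = 1 := by
    have : (deriv G c - 1) * (H b - H a) = 0 := by linarith
    rcases mul_eq_zero.1 this with h | h <;> linarith
  have h5 := hu ζ hζ c hc
  have h6 := hv η hη ξ hξ
  have h7 := abs_iterate_two_sub_le hGm hn (H w)
  rw [hrel] at h1
  have hD := abs_nonneg (G (H w) - H w)
  have hE := abs_nonneg (G w - w)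
  rw [mul_div_assoc', div_le_div_iff₀ hlen hlen']
  have h8 : 7 / 4 * |G (H w) - H w| ≤ deriv H ξ * |G w - w| := by
    rw [← h1]; nlinarith
  calc 21 / 16 * |G (H w) - H w| * (b - a) ≤ 3 / 4 * (deriv H ξ * |G w - w|) * (b - a) := by
        gcongr ?_ * _; linarith
    _ = 3 / 4 * deriv H ξ * (|G w - w| * (b - a)) := by ring
    _ ≤ deriv H η * (|G w - w| * (b - a)) := by gcongr
    _ = |G w - w| * (H b - H a) := by rw [h2]; ring

theorem periodic_deriv_of_map_add_one (G : CircleDeg1Lift) : Function.Periodic (deriv ⇑G) 1 := by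
  intro x
  rw [← deriv_comp_add_const, funext G.map_add_one]
  exact deriv_add_const 1

/-- If `H G = Gⁿ H` with `G` a nontrivial `C¹` lift having fixed points, then some fixed point of
`G` is periodic for the circle map induced by `H`. -/
theorem exists_fixed_eq_add_int {n : ℕ} (hn : 2 ≤ n) (G H : CircleDeg1Liftˣ)
    (hG : IsC1DiffeoLift G) (hH : IsC1DiffeoLift H) (hrel : ∀ x, H (G x) = (⇑G)^[n] (H x))
    (hfix : ∃ x, G x = x) (hne : ∃ x, G x ≠ x) :
    ∃ q, G q = q ∧ ∃ m ≥ 1, ∃ p : ℤ, (⇑H)^[m] q = q + p := by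
  obtain ⟨x₀, hx₀⟩ := hne
  obtain ⟨a, b, hax, hxb, ha, hb, hab⟩ :=
    CircleDeg1Lift.exists_component_of_ne hG.1.continuous hfix hx₀
  have hGd : Differentiable ℝ ⇑G := hG.1.differentiable one_ne_zero
  have hHd : Differentiable ℝ ⇑H := hH.1.differentiable one_ne_zero
  have hHm : StrictMono ⇑H := strictMono_of_deriv_pos hH.2
  have hfixH (x : ℝ) : G (H x) = H x ↔ G x = x := by
    have h := CircleDeg1Lift.iterate_pos_eq_iff (G : CircleDeg1Lift) (x := H x) (m := 0)
      (n := n) (by omega)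
    simp only [Int.cast_zero, mul_zero, add_zero] at h
    rw [← h, ← hrel, hHm.injective.eq_iff]
  set K : ℝ → ℝ := ⇑(H⁻¹ : CircleDeg1Liftˣ)
  have hHK (x : ℝ) : H (K x) = x := CircleDeg1Lift.units_apply_inv_apply H x
  have hKm : StrictMono K := fun x y hxy => by
    rw [← hHm.lt_iff_lt, hHK, hHK]; exact hxy
  have hKk (k : ℕ) : StrictMono K^[k] := hKm.iterate k
  have hHKk (k : ℕ) (x : ℝ) : H (K^[k + 1] x) = K^[k] x := by
    rw [Function.iterate_succ_apply', hHK]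
  have hfixK (k : ℕ) (x : ℝ) : G (K^[k] x) = K^[k] x ↔ G x = x := by
    induction k with
    | zero => rfl
    | succ k ih => rw [← ih, ← hfixH, hHKk]
  have hHiter (i j : ℕ) (x : ℝ) : (⇑H)^[j] (K^[i + j] x) = K^[i] x := by
    induction j with
    | zero => rfl
    | succ j ih => rw [Function.iterate_succ_apply, ← add_assoc, hHKk, ih]
  have hnofix (k : ℕ) {y : ℝ} (hy : y ∈ Ioo (K^[k] a) (K^[k] b)) : G y ≠ y := by
    have hyk : K^[k] ((⇑H)^[k] y) = y := by
      have : Function.LeftInverse K H := CircleDeg1Lift.units_inv_apply_apply H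
      exact this.iterate k y
    rw [← hyk] at hy ⊢
    rw [Ne, hfixK]
    exact hab _ ⟨(hKk k).lt_iff_lt.1 hy.1, (hKk k).lt_iff_lt.1 hy.2⟩
  have hlen1 (k : ℕ) : K^[k] b ≤ K^[k] a + 1 := by
    by_contra! h
    refine hnofix k ⟨lt_add_one _, h⟩ ?_
    rw [CircleDeg1Lift.map_add_one, (hfixK k a).2 ha]
  by_contra! hcon
  have hdisj : Pairwise (Function.onFun Disjoint fun k =>
      Ioo (Int.fract (K^[k] a)) (Int.fract (K^[k] a) + (K^[k] b - K^[k] a))) := by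
    rw [pairwise_disjoint_on]
    intro i j hij
    rw [Set.disjoint_left]
    rintro y ⟨hi1, hi2⟩ ⟨hj1, hj2⟩
    have e1 := Int.floor_add_fract (K^[i] a)
    have e2 := Int.floor_add_fract (K^[j] a)
    have hmem : K^[i] a = K^[j] a + ((⌊K^[i] a⌋ - ⌊K^[j] a⌋ : ℤ) : ℝ) := by
      push_cast
      apply le_antisymm
      · by_contra! h
        refine hnofix j (y := K^[i] a + ((⌊K^[j] a⌋ - ⌊K^[i] a⌋ : ℤ) : ℝ)) ?_ ?_
        · push_cast; constructor <;> linarith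
        · rw [CircleDeg1Lift.map_add_int, (hfixK i a).2 ha]
      · by_contra! h
        refine hnofix i (y := K^[j] a + ((⌊K^[i] a⌋ - ⌊K^[j] a⌋ : ℤ) : ℝ)) ?_ ?_
        · push_cast; constructor <;> linarith
        · rw [CircleDeg1Lift.map_add_int, (hfixK j a).2 ha]
    refine hcon (K^[j] a) ((hfixK j a).2 ha) (j - i) (by omega) _ (Eq.trans ?_ hmem)
    have := hHiter i (j - i) a
    rwa [Nat.add_sub_cancel' hij.le] at this
  have htend := tendsto_sub_zero_of_disjoint_Ioo (A := 0) (B := 2)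
    (fun k => by have := (hKk k) (hax.trans hxb); linarith)
    (fun k => Int.fract_nonneg _)
    (fun k => by have := hlen1 k; have := Int.fract_lt_one (K^[k] a); linarith) hdisj
  simp only [add_sub_cancel_left] at htend
  obtain ⟨δ₁, hδ₁, hu⟩ := exists_delta_mul_le_of_periodic (hG.1.continuous_deriv le_rfl)
    (periodic_deriv_of_map_add_one G) hG.2 (c := 3 / 4) (by norm_num) (by norm_num)
  obtain ⟨δ₂, hδ₂, hv⟩ := exists_delta_mul_le_of_periodic (hH.1.continuous_deriv le_rfl)
    (periodic_deriv_of_map_add_one H) hH.2 (c := 3 / 4) (by norm_num) (by norm_num)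
  obtain ⟨N, hN⟩ := eventually_atTop.1 (htend.eventually_lt_const (lt_min hδ₁ hδ₂))
  set r : ℕ → ℝ := fun k => |G (K^[k] x₀) - K^[k] x₀| / (K^[k] b - K^[k] a) with hr
  have hlenpos (k : ℕ) : 0 < K^[k] b - K^[k] a := sub_pos.2 (hKk k (hax.trans hxb))
  have hmemk (k : ℕ) : K^[k] x₀ ∈ Icc (K^[k] a) (K^[k] b) := ⟨(hKk k hax).le, (hKk k hxb).le⟩
  have hstep (k : ℕ) (hk : N ≤ k) : 21 / 16 * r k ≤ r (k + 1) := by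
    have := displacement_div_length_le hn (G : CircleDeg1Lift).monotone hGd hG.2 hHd hH.2 hrel
      (hmemk (k + 1)) (hKk (k + 1) (hax.trans hxb)) ((hfixK _ a).2 ha) ((hfixK _ b).2 hb)
      (by rw [hfixH]; exact (hfixK _ a).2 ha) (by rw [hfixH]; exact (hfixK _ b).2 hb)
    simp only [hHKk] at this
    refine this ?_ ?_
    · intro x hx y hy
      exact hu x y ((Real.dist_le_of_mem_Icc hx hy).trans_lt
        ((hN k hk).trans_le (min_le_left _ _)))
    · intro x hx y hy
      exact hv x y ((Real.dist_le_of_mem_Icc hx hy).trans_lt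
        ((hN (k + 1) (by omega)).trans_le (min_le_right _ _)))
  have hr1 (k : ℕ) : r k ≤ 1 := by
    rw [hr, div_le_one (hlenpos k)]
    exact Real.dist_le_of_mem_Icc (mem_Icc_of_fixed (G : CircleDeg1Lift).monotone
      ((hfixK k a).2 ha) ((hfixK k b).2 hb) (hmemk k)) (hmemk k)
  have hr0 : 0 < r N :=
    div_pos (abs_pos.2 (sub_ne_zero.2 (by rw [Ne, hfixK]; exact hx₀))) (hlenpos N)
  have hgrow (j : ℕ) : (21 / 16) ^ j * r N ≤ r (N + j) := by
    induction j with
    | zero => simp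
    | succ j ih =>
      have := hstep (N + j) (by omega)
      rw [pow_succ, ← add_assoc]
      linarith
  obtain ⟨j, hj⟩ := pow_unbounded_of_one_lt (1 / r N) (by norm_num : (1 : ℝ) < 21 / 16)
  rw [div_lt_iff₀ hr0] at hj
  linarith [hgrow j, hr1 (N + j)]

end

theorem IsC1DiffeoLift.mul {F G : CircleDeg1Liftˣ} (hF : IsC1DiffeoLift F)
    (hG : IsC1DiffeoLift G) : IsC1DiffeoLift (F * G) := by
  have hcoe : ⇑((F * G : CircleDeg1Liftˣ) : CircleDeg1Lift) = ⇑F ∘ ⇑G := rfl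
  refine ⟨hcoe ▸ hF.1.comp hG.1, fun x => ?_⟩
  rw [hcoe, deriv_comp x (hF.1.differentiable one_ne_zero _) (hG.1.differentiable one_ne_zero _)]
  exact mul_pos (hF.2 _) (hG.2 _)

theorem isC1DiffeoLift_translate (c : ℝ) :
    IsC1DiffeoLift (CircleDeg1Lift.translate (Multiplicative.ofAdd c)) := by
  have hcoe : ⇑(CircleDeg1Lift.translate (Multiplicative.ofAdd c) : CircleDeg1Lift) =
      fun x => c + x := rfl
  refine ⟨hcoe ▸ contDiff_const.add contDiff_id, fun x => ?_⟩
  rw [hcoe, deriv_const_add]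
  simp

theorem IsC1DiffeoLift.pow {F : CircleDeg1Liftˣ} (hF : IsC1DiffeoLift F) (k : ℕ) :
    IsC1DiffeoLift (F ^ k) := by
  induction k with
  | zero => simpa using isC1DiffeoLift_translate 0
  | succ k ih => exact pow_succ F k ▸ ih.mul hF

theorem IsLiftOf.iterate {F : CircleDeg1Liftˣ} {f : S1 ≃ₜ S1} (hF : IsLiftOf F f) (k : ℕ)
    (x : ℝ) : (⇑f)^[k] (x : S1) = (((⇑F)^[k] x : ℝ) : S1) := by
  induction k generalizing x with
  | zero => rfl
  | succ k ih => rw [Function.iterate_succ_apply, Function.iterate_succ_apply, hF, ih]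

theorem S1.coe_add_intCast (x : ℝ) (p : ℤ) : ((x + p : ℝ) : S1) = x := by
  rw [AddCircle.coe_add, (AddCircle.coe_eq_zero_iff (1 : ℝ) (x := p)).2 ⟨p, by simp⟩, add_zero]

theorem exists_forall_eq_intCast_of_continuous {φ : ℝ → ℝ} (hφ : Continuous φ)
    (h : ∀ x, ∃ p : ℤ, φ x = p) : ∃ p : ℤ, ∀ x, φ x = p := by
  choose g hg using h
  have hgc : Continuous g := by
    rw [Int.isClosedEmbedding_coe_real.isInducing.continuous_iff]
    exact hφ.congr hg
  exact ⟨g 0, fun x => by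
    rw [hg, PreconnectedSpace.constant inferInstance hgc (x := x) (y := 0)]⟩

theorem CircleDeg1Lift.commute_translate_intCast (p : ℤ) (F : CircleDeg1Liftˣ) :
    Commute (translate (Multiplicative.ofAdd (p : ℝ))) F := by
  refine Units.ext (CircleDeg1Lift.ext fun x => ?_)
  simp [CircleDeg1Lift.mul_apply, CircleDeg1Lift.map_int_add]

/-- In a group where `H F H⁻¹ = P Fⁿ` with `P` commuting with `F` and `H`, the element
`P Fⁿ⁻¹` is conjugated by `H` to its `n`-th power. -/
theorem SemiconjBy.mul_pow_pred {M : Type*} [Monoid M] {H F P : M} {n : ℕ} (hn : 1 ≤ n)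
    (h : SemiconjBy H F (P * F ^ n)) (hPF : Commute P F) (hPH : Commute P H) :
    SemiconjBy H (P * F ^ (n - 1)) ((P * F ^ (n - 1)) ^ n) := by
  obtain ⟨k, rfl⟩ := Nat.exists_eq_add_of_le' hn
  have h1 : (P * F ^ (k + 1 - 1)) ^ (k + 1) = P * (P * F ^ (k + 1)) ^ k := by
    rw [Nat.add_sub_cancel, (hPF.pow_right k).mul_pow, (hPF.pow_right (k + 1)).mul_pow, pow_succ' P,
      mul_assoc, ← pow_mul, ← pow_mul, mul_comm k]
  rw [h1]
  exact SemiconjBy.mul_right hPH.symm (h.pow_right k)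

/-- The generator `b` has infinite order in `BS(1, n)`. -/
theorem of_one_pow_notMem_normalClosure_bsRel {n k : ℕ} (hn : n ≠ 0) (hk : k ≠ 0) :
    (FreeGroup.of (1 : Fin 2)) ^ k ∉ Subgroup.normalClosure (bsRel n) := by
  have hn' : (n : ℚ) ≠ 0 := Nat.cast_ne_zero.2 hn
  let φ : FreeGroup (Fin 2) →* Equiv.Perm ℚ :=
    FreeGroup.lift ![Equiv.mulLeft₀ (n : ℚ) hn', Equiv.addRight 1]
  have hpow (k : ℕ) (x : ℚ) : ((Equiv.addRight (1 : ℚ)) ^ k) x = x + k := by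
    induction k generalizing x with
    | zero => simp
    | succ k ih =>
      rw [pow_succ, Equiv.Perm.mul_apply, ih]
      simp only [Equiv.coe_addRight]
      push_cast
      ring
  have hker : Subgroup.normalClosure (bsRel n) ≤ φ.ker := by
    refine Subgroup.normalClosure_le_normal ?_
    rintro _ rfl
    rw [SetLike.mem_coe, MonoidHom.mem_ker, map_mul, map_inv, mul_inv_eq_one]
    ext x
    simp only [map_mul, map_inv, map_pow, φ, FreeGroup.lift_apply_of, Matrix.cons_val_zero,
      Matrix.cons_val_one, hpow, Equiv.Perm.mul_apply]
    simp only [Equiv.coe_addRight, Equiv.mulLeft₀_apply, Equiv.Perm.inv_def,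
      Equiv.mulLeft₀_symm_apply]
    field_simp
  intro hmem
  have h := hker hmem
  rw [MonoidHom.mem_ker, map_pow] at h
  have h0 := DFunLike.congr_fun h (0 : ℚ)
  simp only [φ, FreeGroup.lift_apply_of, Matrix.cons_val_one, Matrix.cons_val_zero, hpow] at h0
  simp at h0
  exact hk h0

/-- Let `n ≥ 2` and let `f, h` be orientation-preserving `C¹`
diffeomorphisms of the circle satisfying `h ∘ f ∘ h⁻¹ = fⁿ` (equivalently
`h ∘ f = fⁿ ∘ h`) and generating a faithful `BS(1,n)`-action.  Then there exists
`m ≥ 1` such that `f^(n-1)` and `h^m` have a common fixed point. -/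
theorem exists_common_fixed_point
    (n : ℕ) (hn : 2 ≤ n) (f h : S1 ≃ₜ S1) (F H : CircleDeg1Liftˣ)
    (hF : IsLiftOf F f) (hH : IsLiftOf H h)
    (hFc1 : IsC1DiffeoLift F) (hHc1 : IsC1DiffeoLift H)
    (hrel : ∀ x : S1, h (f x) = (⇑f)^[n] (h x))
    (hfaith : IsFaithfulBS n f h) :
    ∃ m : ℕ, 1 ≤ m ∧ ∃ q : S1, (⇑f)^[n - 1] q = q ∧ (⇑h)^[m] q = q := by
  have hFit := hF.iterate
  obtain ⟨p, hp⟩ : ∃ p : ℤ, ∀ x, H (F x) - (⇑F)^[n] (H x) = p := by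
    refine exists_forall_eq_intCast_of_continuous ?_ fun x => ?_
    · exact (hHc1.1.continuous.comp hFc1.1.continuous).sub
        ((hFc1.1.continuous.iterate n).comp hHc1.1.continuous)
    · have h1 := hrel x
      rw [hF, hH, hH, hFit, ← sub_eq_zero, ← AddCircle.coe_sub, AddCircle.coe_eq_zero_iff] at h1
      obtain ⟨p, h2⟩ := h1
      exact ⟨p, by rw [← h2]; simp⟩
  set P := CircleDeg1Lift.translate (Multiplicative.ofAdd (p : ℝ))
  have hcomm := CircleDeg1Lift.commute_translate_intCast p
  have hPapp (U : CircleDeg1Liftˣ) (x : ℝ) : (P * U : CircleDeg1Liftˣ) x = p + U x := rfl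
  have hpow (U : CircleDeg1Liftˣ) (k : ℕ) : ⇑((U ^ k : CircleDeg1Liftˣ) : CircleDeg1Lift) =
      (⇑U)^[k] := by
    rw [Units.val_pow_eq_pow_val, CircleDeg1Lift.coe_pow]
  have hconj : SemiconjBy H F (P * F ^ n) := by
    refine Units.ext (CircleDeg1Lift.ext fun x => ?_)
    change H (F x) = p + (F ^ n : CircleDeg1Liftˣ) (H x)
    rw [hpow]
    linarith [hp x]
  have hτmul (k : ℕ) : CircleDeg1Lift.translationNumber ((P * F ^ k : CircleDeg1Liftˣ) :) =
      p + k * CircleDeg1Lift.translationNumber F := by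
    rw [Units.val_mul, CircleDeg1Lift.translationNumber_mul_of_commute
      ((hcomm (F ^ k)).units_val), Units.val_pow_eq_pow_val,
      CircleDeg1Lift.translationNumber_pow, CircleDeg1Lift.translationNumber_translate]
  have hτF := (CircleDeg1Lift.translationNumber_eq_of_semiconjBy hconj.units_val).trans (hτmul n)
  set G : CircleDeg1Liftˣ := P * F ^ (n - 1) with hG
  have hGc1 : IsC1DiffeoLift G := (isC1DiffeoLift_translate _).mul (hFc1.pow _)
  have hGapp (x : ℝ) : G x = p + (⇑F)^[n - 1] x := by rw [hG, hPapp, hpow]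
  have hτG : CircleDeg1Lift.translationNumber G = (0 : ℤ) := by
    rw [hτmul, Nat.cast_sub (by omega)]
    push_cast
    linarith
  have hfG (x : ℝ) (hx : G x = x) : (⇑f)^[n - 1] (x : S1) = x := by
    rw [hFit, ← S1.coe_add_intCast _ p, add_comm, ← hGapp, hx]
  have hGrel (x : ℝ) : H (G x) = (⇑G)^[n] (H x) := by
    have h1 : H * G = G ^ n * H :=
      hconj.mul_pow_pred (by omega) (hcomm F) (hcomm H)
    rw [← hpow]
    exact congrArg (fun U : CircleDeg1Liftˣ => U x) h1
  obtain ⟨q, hq, m, hm, k, hk⟩ := exists_fixed_eq_add_int hn G H hGc1 hHc1 hGrel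
    (by simpa using ((G : CircleDeg1Lift).translationNumber_eq_int_iff hGc1.1.continuous).1 hτG)
    (by
      by_contra! hid
      refine of_one_pow_notMem_normalClosure_bsRel (n := n) (k := n - 1) (by omega) (by omega)
        (hfaith _ ?_)
      rw [map_pow, FreeGroup.lift_apply_of]
      ext y
      induction y using QuotientAddGroup.induction_on with | H x =>
      rw [← Equiv.Perm.iterate_eq_pow]
      exact hfG x (hid x))
  exact ⟨m, hm, q, hfG q hq, by rw [hH.iterate, hk, S1.coe_add_intCast]⟩
end
end

section
/- Let n ≥ 2 and let f, h : S¹ → S¹ be orientation-preserving homeomorphisms of the circle satisfying h ∘ f ∘ h⁻¹ = fⁿ. Then f^{n−1} has a fixed point in S¹. -/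
noncomputable section

/-- A continuous real function all of whose values are integers is constant. -/
theorem exists_eq_intCast_of_continuous {φ : ℝ → ℝ} (hφ : Continuous φ)
    (hint : ∀ x, ∃ m : ℤ, φ x = m) : ∃ m : ℤ, ∀ x, φ x = m := by
  choose k hk using hint
  have hk_cont : Continuous k := by
    rw [Int.isClosedEmbedding_coe_real.isEmbedding.continuous_iff]
    exact hφ.congr hk
  exact ⟨k 0, fun x => by rw [hk, PreconnectedSpace.constant inferInstance hk_cont (y := 0)]⟩

theorem CircleDeg1Lift.continuous_units (F : CircleDeg1Liftˣ) :
    Continuous (F : CircleDeg1Lift) :=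
  (CircleDeg1Lift.toOrderIso F).continuous

theorem IsLiftOf.iterate_coe {F : CircleDeg1Liftˣ} {g : S1 ≃ₜ S1} (hF : IsLiftOf F g)
    (k : ℕ) (x : ℝ) :
    (⇑g)^[k] (x : S1) = ((((F : CircleDeg1Lift) ^ k) x : ℝ) : S1) := by
  rw [CircleDeg1Lift.coe_pow]
  exact ((show Function.Semiconj (fun y : ℝ => (y : S1)) (F : CircleDeg1Lift) g from
    fun y => (hF y).symm).iterate_right k x).symm

/-- Let `n ≥ 2` and let `f, h` be orientation-preserving circle
homeomorphisms satisfying `h ∘ f ∘ h⁻¹ = fⁿ` (equivalently `h ∘ f = fⁿ ∘ h`).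
Then `f^(n-1)` has a fixed point. -/
theorem f_pow_has_fixed_point
    (n : ℕ) (hn : 2 ≤ n) (f h : S1 ≃ₜ S1) (F H : CircleDeg1Liftˣ)
    (hF : IsLiftOf F f) (hH : IsLiftOf H h)
    (hrel : ∀ x : S1, h (f x) = (⇑f)^[n] (h x)) :
    ∃ q : S1, (⇑f)^[n - 1] q = q := by
  have hFc := CircleDeg1Lift.continuous_units F
  have hHc := CircleDeg1Lift.continuous_units H
  obtain ⟨m, hm⟩ : ∃ m : ℤ, ∀ x : ℝ, (H : CircleDeg1Lift) ((F : CircleDeg1Lift) x) -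
      ((F : CircleDeg1Lift) ^ n) ((H : CircleDeg1Lift) x) = m := by
    refine exists_eq_intCast_of_continuous
      ((hHc.comp hFc).sub ((CircleDeg1Lift.continuous_pow _ hFc n).comp hHc)) fun x => ?_
    have hx := hrel x
    rw [hF, hH, hH, hF.iterate_coe, ← sub_eq_zero, ← AddCircle.coe_sub,
      AddCircle.coe_eq_zero_iff] at hx
    obtain ⟨m, hm⟩ := hx
    exact ⟨m, by simpa using hm.symm⟩
  set T : CircleDeg1Liftˣ := CircleDeg1Lift.translate (Multiplicative.ofAdd (m : ℝ))
  have hsemi : SemiconjBy (H : CircleDeg1Lift) F (T * (F : CircleDeg1Lift) ^ n) := by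
    ext x
    simp only [CircleDeg1Lift.mul_apply, T, CircleDeg1Lift.translate_apply]
    linarith [hm x]
  have hcomm : Commute (T : CircleDeg1Lift) ((F : CircleDeg1Lift) ^ n) := by
    ext x
    simp only [CircleDeg1Lift.mul_apply, T, CircleDeg1Lift.translate_apply,
      CircleDeg1Lift.map_int_add]
  have hτ := CircleDeg1Lift.translationNumber_eq_of_semiconjBy hsemi
  rw [CircleDeg1Lift.translationNumber_mul_of_commute hcomm,
    CircleDeg1Lift.translationNumber_translate, CircleDeg1Lift.translationNumber_pow] at hτ
  have hτ_pow : CircleDeg1Lift.translationNumber ((F : CircleDeg1Lift) ^ (n - 1)) =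
      ((-m : ℤ) : ℝ) := by
    rw [CircleDeg1Lift.translationNumber_pow, Nat.cast_sub (by omega)]
    push_cast
    linarith
  obtain ⟨x, hx⟩ := (CircleDeg1Lift.translationNumber_eq_int_iff _
    (CircleDeg1Lift.continuous_pow _ hFc (n - 1))).1 hτ_pow
  refine ⟨x, ?_⟩
  rw [hF.iterate_coe, hx, ← sub_eq_zero, ← AddCircle.coe_sub, AddCircle.coe_eq_zero_iff]
  exact ⟨-m, by simp⟩
end
end
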